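/- For every y in the interval [2/3, 1], it holds that P(y) ≥ R + 3·ξc·y − 3·ξc. -/

import Mathlib

open Real

noncomputable def R : ℝ := 1 / (1 + Real.log 2)

noncomputable def f (x : ℝ) : ℝ :=
  if x ≤ R then 1/2 else (2 * Real.exp 1) ^ (x - 1)

noncomputable def F (x : ℝ) : ℝ :=
  if x ≤ R then x/2 else R * (2 * Real.exp 1) ^ (x - 1)

noncomputable def P (c : ℝ) : ℝ := ∫ y in (0:ℝ)..1, min (f y) c

noncomputable def Q (c : ℝ) : ℝ := ∫ y in (0:ℝ)..1, max (c - f y) 0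

noncomputable def xic : ℝ := (1 + (2/3) * Real.log (4/3)) * R - 2/3

noncomputable def phi : ℝ := (2/3) * xic / (2/3 - R + xic)

noncomputable def xi (x : ℝ) : ℝ :=
  if x ≤ 1/3 then xic / x else 9 * xic * (1 - 2 * x)

noncomputable def T (a b : ℝ) : ℝ := (a + b - 1/2) * (xi b - xi a)

noncomputable def pile (x : ℝ) : ℝ := max (2/3) (2 * x)

lemma one_add_log_two_pos : 0 < 1 + Real.log 2 := by
  have := Real.log_pos (one_lt_two)
  linarith

lemma R_pos : 0 < R := one_div_pos.2 one_add_log_two_pos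

lemma R_mul_one_add_log_two : R * (1 + Real.log 2) = 1 :=
  one_div_mul_cancel one_add_log_two_pos.ne'

lemma two_mul_exp_one_rpow (x : ℝ) :
    (2 * Real.exp 1) ^ x = Real.exp ((1 + Real.log 2) * x) := by
  rw [Real.rpow_def_of_pos (by positivity), Real.log_mul (by norm_num) (Real.exp_ne_zero _),
    Real.log_exp, add_comm]

lemma integral_exp_one_add_log_two_mul_sub_one (a b : ℝ) :
    ∫ x in a..b, Real.exp ((1 + Real.log 2) * (x - 1)) =
      R * Real.exp ((1 + Real.log 2) * (b - 1)) - R * Real.exp ((1 + Real.log 2) * (a - 1)) := by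
  refine intervalIntegral.integral_eq_sub_of_hasDerivAt
    (f := fun x => R * Real.exp ((1 + Real.log 2) * (x - 1))) (fun x _ => ?_)
    (Continuous.intervalIntegrable (by fun_prop) _ _)
  refine (((((hasDerivAt_id x).sub_const 1).const_mul (1 + Real.log 2)).exp).const_mul
    R).congr_deriv ?_
  simp only [id]
  linear_combination Real.exp ((1 + Real.log 2) * (x - 1)) * R_mul_one_add_log_two

/-- The closed form of `P` on `[1/2, 1]`. -/
lemma P_eq {c : ℝ} (hc : 1 / 2 ≤ c) (hc1 : c ≤ 1) : P c = R * (c + Real.negMulLog c) := by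
  have hc0 : 0 < c := by linarith
  have hR := R_mul_one_add_log_two
  set t := 1 + R * Real.log c with ht
  have hlog : -Real.log 2 ≤ Real.log c := by
    rw [← Real.log_inv]
    exact Real.log_le_log (by norm_num) (by linarith)
  have hRt : R ≤ t := by nlinarith [mul_le_mul_of_nonneg_left hlog R_pos.le]
  have ht1 : t ≤ 1 := by nlinarith [mul_nonneg R_pos.le (neg_nonneg.2 (Real.log_nonpos hc0.le hc1))]
  have hexp_t : Real.exp ((1 + Real.log 2) * (t - 1)) = c := by
    rw [show (1 + Real.log 2) * (t - 1) = Real.log c by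
      rw [ht]; linear_combination Real.log c * hR, Real.exp_log hc0]
  have hexp_R : Real.exp ((1 + Real.log 2) * (R - 1)) = 1 / 2 := by
    rw [show (1 + Real.log 2) * (R - 1) = -Real.log 2 by linear_combination hR, Real.exp_neg,
      Real.exp_log two_pos, one_div]
  have h₀ : Set.EqOn (fun x => min (f x) c) (fun _ => 1 / 2) (Set.uIoc 0 R) := fun x hx => by
    rw [Set.uIoc_of_le R_pos.le] at hx
    simp [f, hx.2, -one_div, hc]
  have h₁ : Set.EqOn (fun x => min (f x) c)
      (fun x => Real.exp ((1 + Real.log 2) * (x - 1))) (Set.uIoc R t) := fun x hx => by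
    rw [Set.uIoc_of_le hRt] at hx
    have : Real.exp ((1 + Real.log 2) * (x - 1)) ≤ c := by
      rw [← hexp_t]
      gcongr
      exact hx.2
    simp [f, not_le.2 hx.1, two_mul_exp_one_rpow, this]
  have h₂ : Set.EqOn (fun x => min (f x) c) (fun _ => c) (Set.uIoc t 1) := fun x hx => by
    rw [Set.uIoc_of_le ht1] at hx
    have : c ≤ Real.exp ((1 + Real.log 2) * (x - 1)) := by
      rw [← hexp_t]
      gcongr
      exact hx.1.le
    simp [f, not_le.2 (hRt.trans_lt hx.1), two_mul_exp_one_rpow, this]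
  have i₀ : IntervalIntegrable (fun x => min (f x) c) MeasureTheory.volume 0 R :=
    intervalIntegrable_const.congr h₀.symm
  have i₁ : IntervalIntegrable (fun x => min (f x) c) MeasureTheory.volume R t :=
    (Continuous.intervalIntegrable (by fun_prop) _ _).congr h₁.symm
  have i₂ : IntervalIntegrable (fun x => min (f x) c) MeasureTheory.volume t 1 :=
    intervalIntegrable_const.congr h₂.symm
  rw [P, ← intervalIntegral.integral_add_adjacent_intervals (i₀.trans i₁) i₂,
    ← intervalIntegral.integral_add_adjacent_intervals i₀ i₁,
    intervalIntegral.integral_congr_ae (.of_forall h₀),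
    intervalIntegral.integral_congr_ae (.of_forall h₁),
    intervalIntegral.integral_congr_ae (.of_forall h₂), integral_exp_one_add_log_two_mul_sub_one, hexp_t, hexp_R]
  simp only [intervalIntegral.integral_const, smul_eq_mul, Real.negMulLog, ht]
  ring

/-- The chord of `x ↦ R * (x + negMulLog x)` on `[2/3, 1]` has slope `3 * xic`. -/
lemma R_mul_two_thirds_add_negMulLog :
    R * (2 / 3 + Real.negMulLog (2 / 3)) = R - xic := by
  have h43 : Real.log (4 / 3) = 2 * Real.log 2 - Real.log 3 := by
    rw [Real.log_div (by norm_num) (by norm_num), show (4 : ℝ) = 2 ^ 2 by norm_num, Real.log_pow]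
    norm_num
  rw [xic, Real.negMulLog, h43, Real.log_div (by norm_num) (by norm_num)]
  linear_combination (2 / 3) * R_mul_one_add_log_two

theorem stmt_10 : ∀ y ∈ Set.Icc (2/3 : ℝ) 1, P y ≥ R + 3 * xic * y - 3 * xic := by
  rintro y ⟨hy, hy1⟩
  rw [P_eq (by linarith) hy1]
  obtain ⟨-, hconc⟩ := Real.concaveOn_negMulLog
  replace hconc := hconc (show (2 / 3 : ℝ) ∈ Set.Ici 0 by norm_num)
    (show (1 : ℝ) ∈ Set.Ici 0 by norm_num) (a := 3 - 3 * y) (b := 3 * y - 2) (by linarith) (by linarith)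
    (by ring)
  simp only [smul_eq_mul, Real.negMulLog_one] at hconc
  rw [show (3 - 3 * y) * (2 / 3) + (3 * y - 2) * 1 = y by ring] at hconc
  linear_combination mul_le_mul_of_nonneg_left hconc R_pos.le -
    (3 - 3 * y) * R_mul_two_thirds_add_negMulLog
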